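/- An infinite Hausdorff space X is ω-Lindelöf if and only if (𝔽(X), V⁺) is ω-Lindelöf. -/

import Mathlib

open Set Filter Pointwise

universe u

/-- The selection principle `S₁(𝒜,ℬ)`: for each sequence of elements of `𝒜` one can pick one
element from each term so that the set of chosen elements belongs to `ℬ`. -/
def S1 {Y : Type u} (cA cB : Set (Set Y)) : Prop :=
  ∀ A : ℕ → Set Y, (∀ n, A n ∈ cA) →
    ∃ b : ℕ → Y, (∀ n, b n ∈ A n) ∧ Set.range b ∈ cB

/-- `α₁(𝒜,ℬ)`: for each sequence of infinite elements of `𝒜` there is `B ∈ ℬ` such that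
`Aₙ \ B` is finite for each `n`. -/
def Alpha1 {Y : Type u} (cA cB : Set (Set Y)) : Prop :=
  ∀ A : ℕ → Set Y, (∀ n, A n ∈ cA ∧ (A n).Infinite) →
    ∃ B ∈ cB, ∀ n, (A n \ B).Finite

/-- `α₂(𝒜,ℬ)`: for each sequence of infinite elements of `𝒜` there is `B ∈ ℬ` such that
`Aₙ ∩ B` is infinite for each `n`. -/
def Alpha2 {Y : Type u} (cA cB : Set (Set Y)) : Prop :=
  ∀ A : ℕ → Set Y, (∀ n, A n ∈ cA ∧ (A n).Infinite) →
    ∃ B ∈ cB, ∀ n, (A n ∩ B).Infinite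

/-- `α₃(𝒜,ℬ)`: for each sequence of infinite elements of `𝒜` there is `B ∈ ℬ` such that
`Aₙ ∩ B` is infinite for infinitely many `n`. -/
def Alpha3 {Y : Type u} (cA cB : Set (Set Y)) : Prop :=
  ∀ A : ℕ → Set Y, (∀ n, A n ∈ cA ∧ (A n).Infinite) →
    ∃ B ∈ cB, {n : ℕ | (A n ∩ B).Infinite}.Infinite

/-- `α₄(𝒜,ℬ)`: for each sequence of infinite elements of `𝒜` there is `B ∈ ℬ` such that
`Aₙ ∩ B` is nonempty for infinitely many `n`. -/
def Alpha4 {Y : Type u} (cA cB : Set (Set Y)) : Prop :=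
  ∀ A : ℕ → Set Y, (∀ n, A n ∈ cA ∧ (A n).Infinite) →
    ∃ B ∈ cB, {n : ℕ | (A n ∩ B).Nonempty}.Infinite

/-- An ω-cover: a nontrivial open cover such that every finite set lies in some member. -/
def IsOmegaCover {Y : Type u} [TopologicalSpace Y] (cU : Set (Set Y)) : Prop :=
  (∀ U ∈ cU, IsOpen U) ∧ ⋃₀ cU = Set.univ ∧ Set.univ ∉ cU ∧
    ∀ F : Set Y, F.Finite → ∃ U ∈ cU, F ⊆ U

/-- A k-cover: a nontrivial open cover such that every compact set lies in some member. -/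
def IsKCover {Y : Type u} [TopologicalSpace Y] (cU : Set (Set Y)) : Prop :=
  (∀ U ∈ cU, IsOpen U) ∧ ⋃₀ cU = Set.univ ∧ Set.univ ∉ cU ∧
    ∀ K : Set Y, IsCompact K → ∃ U ∈ cU, K ⊆ U

/-- A γ-cover: an infinite open cover such that each finite set is contained in all but
finitely many members. -/
def IsGammaCover {Y : Type u} [TopologicalSpace Y] (cU : Set (Set Y)) : Prop :=
  (∀ U ∈ cU, IsOpen U) ∧ ⋃₀ cU = Set.univ ∧ cU.Infinite ∧
    ∀ F : Set Y, F.Finite → {U ∈ cU | ¬ F ⊆ U}.Finite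

/-- A γₖ-cover: an infinite open cover such that each compact set is contained in all but
finitely many members. -/
def IsGammaKCover {Y : Type u} [TopologicalSpace Y] (cU : Set (Set Y)) : Prop :=
  (∀ U ∈ cU, IsOpen U) ∧ ⋃₀ cU = Set.univ ∧ cU.Infinite ∧
    ∀ K : Set Y, IsCompact K → {U ∈ cU | ¬ K ⊆ U}.Finite

/-- `Ω`: the collection of ω-covers of `Y`. -/
def OmegaCovers (Y : Type u) [TopologicalSpace Y] : Set (Set (Set Y)) :=
  {cU | IsOmegaCover cU}

/-- `𝒦`: the collection of k-covers of `Y`. -/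
def KCovers (Y : Type u) [TopologicalSpace Y] : Set (Set (Set Y)) :=
  {cU | IsKCover cU}

/-- `Γ`: the collection of γ-covers of `Y`. -/
def GammaCovers (Y : Type u) [TopologicalSpace Y] : Set (Set (Set Y)) :=
  {cU | IsGammaCover cU}

/-- `Γₖ`: the collection of γₖ-covers of `Y`. -/
def GammaKCovers (Y : Type u) [TopologicalSpace Y] : Set (Set (Set Y)) :=
  {cU | IsGammaKCover cU}

/-- `Y` is ω-Lindelöf if every ω-cover contains a countable ω-cover. -/
def OmegaLindelof (Y : Type u) [TopologicalSpace Y] : Prop :=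
  ∀ cU : Set (Set Y), IsOmegaCover cU →
    ∃ cV ⊆ cU, cV.Countable ∧ IsOmegaCover cV

/-- `Y` is k-Lindelöf if every k-cover contains a countable k-cover. -/
def KLindelof (Y : Type u) [TopologicalSpace Y] : Prop :=
  ∀ cU : Set (Set Y), IsKCover cU →
    ∃ cV ⊆ cU, cV.Countable ∧ IsKCover cV

/-- `Ω_y`: subsets of `Y \ {y}` having `y` in their closure. -/
def OmegaPt {Y : Type u} [TopologicalSpace Y] (y : Y) : Set (Set Y) :=
  {A | A ⊆ {y}ᶜ ∧ y ∈ closure A}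

/-- `Σ_y`: (ranges of) nontrivial sequences in `Y` converging to `y`. -/
def SigmaPt {Y : Type u} [TopologicalSpace Y] (y : Y) : Set (Set Y) :=
  {S | ∃ f : ℕ → Y, (∀ n, f n ≠ y) ∧
    Filter.Tendsto f Filter.atTop (nhds y) ∧ S = Set.range f}

/-- `2^X`: the hyperspace of closed subsets of `X`. -/
abbrev HClosed (X : Type u) [TopologicalSpace X] : Type u := {F : Set X // IsClosed F}

/-- The upper Fell topology on `2^X`, generated by the base
`{(Kᶜ)⁺ : K nonempty compact} ∪ {univ}`. -/
instance fellTopology (X : Type u) [TopologicalSpace X] : TopologicalSpace (HClosed X) :=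
  TopologicalSpace.generateFrom
    ({S | ∃ K : Set X, IsCompact K ∧ K.Nonempty ∧ S = {F : HClosed X | F.1 ⊆ Kᶜ}} ∪
      {Set.univ})

/-- `𝕂(X)`: the hyperspace of nonempty compact subsets of `X`. -/
abbrev KSp (X : Type u) [TopologicalSpace X] : Type u := {K : Set X // IsCompact K ∧ K.Nonempty}

/-- The upper Vietoris topology on `𝕂(X)`, generated by the base of sets `U⁺`, `U` open. -/
instance upperVietorisK (X : Type u) [TopologicalSpace X] : TopologicalSpace (KSp X) :=
  TopologicalSpace.generateFrom
    {S | ∃ U : Set X, IsOpen U ∧ S = {K : KSp X | K.1 ⊆ U}}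

/-- `𝔽(X)`: the hyperspace of nonempty finite subsets of `X`. -/
abbrev FSp (X : Type u) [TopologicalSpace X] : Type u := {F : Set X // F.Finite ∧ F.Nonempty}

/-- The upper Vietoris topology on `𝔽(X)`, generated by the base of sets `U⁺`, `U` open. -/
instance upperVietorisF (X : Type u) [TopologicalSpace X] : TopologicalSpace (FSp X) :=
  TopologicalSpace.generateFrom
    {S | ∃ U : Set X, IsOpen U ∧ S = {F : FSp X | F.1 ⊆ U}}

/-- For a topological group `G` with local base `Be` at the neutral element:
`Ω(e) = {ω(U) : U ∈ Be, no nonempty finite F with F·U = G}` where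
`ω(U) = {F·U : F nonempty finite}`. -/
def OmegaE {G : Type u} [Group G] (Be : Set (Set G)) : Set (Set (Set G)) :=
  {cU | ∃ U ∈ Be,
    (¬ ∃ F : Set G, F.Finite ∧ F.Nonempty ∧ F * U = Set.univ) ∧
    cU = {V | ∃ F : Set G, F.Finite ∧ F.Nonempty ∧ V = F * U}}

/-- For a topological group `G` with local base `Be` at the neutral element:
`𝒦(e) = {k(U) : U ∈ Be, no nonempty compact K with K·U = G}` where
`k(U) = {K·U : K nonempty compact}`. -/
def KcalE {G : Type u} [Group G] [TopologicalSpace G] (Be : Set (Set G)) :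
    Set (Set (Set G)) :=
  {cU | ∃ U ∈ Be,
    (¬ ∃ K : Set G, IsCompact K ∧ K.Nonempty ∧ K * U = Set.univ) ∧
    cU = {V | ∃ K : Set G, IsCompact K ∧ K.Nonempty ∧ V = K * U}}

/-- Player ONE has a winning strategy in the game `G₁(𝒜,ℬ)`: a strategy assigns to each finite
sequence of TWO's previous moves a member of `𝒜`; it is winning if for every play in which
TWO's moves follow it, the set of TWO's moves is not in `ℬ`. -/
def OneHasWinningStrategy {Y : Type u} (cA cB : Set (Set Y)) : Prop :=
  ∃ σ : List Y → Set Y, (∀ l : List Y, σ l ∈ cA) ∧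
    ∀ b : ℕ → Y, (∀ n, b n ∈ σ (List.ofFn fun i : Fin n => b i)) → Set.range b ∉ cB

theorem exists_plus_subset {X : Type u} [TopologicalSpace X] {W : Set (FSp X)}
    (hW : IsOpen W) : ∀ F ∈ W, ∃ U : Set X, IsOpen U ∧ F.1 ⊆ U ∧ ∀ G : FSp X, G.1 ⊆ U → G ∈ W := by
  have hW' : TopologicalSpace.GenerateOpen
      {S | ∃ U : Set X, IsOpen U ∧ S = {F : FSp X | F.1 ⊆ U}} W := hW
  clear hW
  induction hW' with
  | basic s hs =>
    obtain ⟨U, hU, rfl⟩ := hs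
    intro F hF
    exact ⟨U, hU, hF, fun G hG => hG⟩
  | univ => exact fun F _ => ⟨Set.univ, isOpen_univ, Set.subset_univ _, fun _ _ => trivial⟩
  | inter s t _ _ ihs iht =>
    rintro F ⟨h1, h2⟩
    obtain ⟨U, hU, hFU, hU'⟩ := ihs F h1
    obtain ⟨V, hV, hFV, hV'⟩ := iht F h2
    exact ⟨U ∩ V, hU.inter hV, Set.subset_inter hFU hFV, fun G hG =>
      ⟨hU' G (hG.trans Set.inter_subset_left), hV' G (hG.trans Set.inter_subset_right)⟩⟩
  | sUnion S _ ih =>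
    rintro F ⟨s, hs, hF⟩
    obtain ⟨U, hU, hFU, hU'⟩ := ih s hs F hF
    exact ⟨U, hU, hFU, fun G hG => ⟨s, hs, hU' G hG⟩⟩

theorem isOmegaCover_mk {Y : Type u} [TopologicalSpace Y] {cU : Set (Set Y)}
    (h1 : ∀ U ∈ cU, IsOpen U) (h2 : Set.univ ∉ cU)
    (h3 : ∀ F : Set Y, F.Finite → ∃ U ∈ cU, F ⊆ U) : IsOmegaCover cU := by
  refine ⟨h1, Set.eq_univ_of_forall fun y => ?_, h2, h3⟩
  obtain ⟨U, hU, hy⟩ := h3 {y} (Set.finite_singleton y)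
  exact ⟨U, hU, hy rfl⟩

/-- Proposition: `X` is ω-Lindelöf iff `(𝔽(X), V⁺)` is ω-Lindelöf. -/
theorem stmt12 (X : Type u) [TopologicalSpace X] [T2Space X] [Infinite X] :
    OmegaLindelof X ↔ OmegaLindelof (FSp X) := by
  constructor
  · intro hX cW hW
    obtain ⟨hWo, -, hWn, hWf⟩ := hW
    have hV : IsOmegaCover {V : Set X | IsOpen V ∧ ∃ W ∈ cW, ∀ G : FSp X, G.1 ⊆ V → G ∈ W} := by
      refine isOmegaCover_mk (fun U hU => hU.1) ?_ ?_
      · rintro ⟨-, W, hW, h⟩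
        exact hWn ((Set.eq_univ_of_forall fun G => h G (Set.subset_univ _)) ▸ hW)
      · intro F hF
        obtain ⟨x⟩ : Nonempty X := inferInstance
        let F' : FSp X := ⟨insert x F, hF.insert x, Set.insert_nonempty x F⟩
        obtain ⟨W, hW, hFW⟩ := hWf {F'} (Set.finite_singleton _)
        obtain ⟨U, hU, hFU, h⟩ := exists_plus_subset (hWo W hW) F' (hFW rfl)
        exact ⟨U, ⟨hU, W, hW, h⟩, (Set.subset_insert x F).trans hFU⟩
    obtain ⟨cV, hsub, hc, hcV⟩ := hX _ hV
    have hex : ∀ V : Set X, ∃ W, V ∈ cV → W ∈ cW ∧ ∀ G : FSp X, G.1 ⊆ V → G ∈ W := by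
      intro V
      by_cases h : V ∈ cV
      · obtain ⟨-, W, hW, h'⟩ := hsub h
        exact ⟨W, fun _ => ⟨hW, h'⟩⟩
      · exact ⟨∅, fun h' => absurd h' h⟩
    choose f hf using hex
    have hs : f '' cV ⊆ cW := by
      rintro _ ⟨V, hV, rfl⟩
      exact (hf V hV).1
    refine ⟨f '' cV, hs, hc.image f, isOmegaCover_mk (fun U hU => hWo U (hs hU))
      (fun h => hWn (hs h)) ?_⟩
    intro 𝒢 h𝒢
    obtain ⟨V, hV, hGV⟩ := hcV.2.2.2 (⋃ G ∈ 𝒢, G.1) (h𝒢.biUnion fun G _ => G.2.1)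
    exact ⟨f V, ⟨V, hV, rfl⟩, fun G hG => (hf V hV).2 G
      ((Set.subset_biUnion_of_mem (u := fun G : FSp X => G.1) hG).trans hGV)⟩
  · intro hF cU hU
    obtain ⟨hUo, -, hUn, hUf⟩ := hU
    let p : Set X → Set (FSp X) := fun U => {F | F.1 ⊆ U}
    let sg : X → FSp X := fun x => ⟨{x}, Set.finite_singleton x, Set.singleton_nonempty x⟩
    have hsg : ∀ x U, sg x ∈ p U ↔ x ∈ U := fun x U => Set.singleton_subset_iff
    have hP : IsOmegaCover (p '' cU) := by
      refine isOmegaCover_mk ?_ ?_ ?_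
      · rintro _ ⟨U, hU, rfl⟩
        exact TopologicalSpace.GenerateOpen.basic _ ⟨U, hUo U hU, rfl⟩
      · rintro ⟨U, hU, h⟩
        refine hUn ((Set.eq_univ_of_forall fun x => ?_) ▸ hU)
        rw [← hsg, h]
        trivial
      · intro 𝒢 h𝒢
        obtain ⟨V, hV, hGV⟩ := hUf (⋃ G ∈ 𝒢, G.1) (h𝒢.biUnion fun G _ => G.2.1)
        exact ⟨p V, ⟨V, hV, rfl⟩, fun G hG =>
          (Set.subset_biUnion_of_mem (u := fun G : FSp X => G.1) hG).trans hGV⟩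
    obtain ⟨cV, hsub, hc, hcV⟩ := hF _ hP
    have hinj : Function.Injective p := by
      intro U V h
      ext x
      rw [← hsg, h, hsg]
    refine ⟨cU ∩ p ⁻¹' cV, Set.inter_subset_left,
      (hc.preimage_of_injOn hinj.injOn).mono Set.inter_subset_right,
      isOmegaCover_mk (fun U hU => hUo U hU.1) (fun h => hUn h.1) ?_⟩
    intro F hFf
    obtain ⟨W, hW, hFW⟩ := hcV.2.2.2 (sg '' F) (hFf.image sg)
    obtain ⟨U, hU, rfl⟩ := hsub hW
    exact ⟨U, ⟨hU, hW⟩, fun x hx => (hsg x U).1 (hFW ⟨x, hx, rfl⟩)⟩
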